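/- Over a two-letter alphabet {a,b} with a < b, an infinite word t is fine (i.e., (min(t), max(t)) = (a·s, b·s) for some infinite word s) if and only if either t is a Sturmian word, or t = v·μ(x)^ω where μ is a pure standard Sturmian morphism on {a,b} and v is a non-empty suffix of μ(x^p y) for some p ∈ ℕ and distinct letters x, y ∈ {a,b}. -/

import Mathlib

/-- The prefix of length `k` of an infinite word `w : ℕ → A`. -/
def pref {A : Type*} (w : ℕ → A) (k : ℕ) : List A := (List.range k).map w

/-- `u` is a (finite) factor of the infinite word `w`. -/
def IsFactor {A : Type*} (w : ℕ → A) (u : List A) : Prop :=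
  ∃ i : ℕ, u = (List.range u.length).map (fun j => w (i + j))

/-- Prepend a letter to an infinite word. -/
def consW {A : Type*} (a : A) (s : ℕ → A) : ℕ → A := fun n => match n with
  | 0 => a
  | n + 1 => s n

/-- Concatenation of a finite word with an infinite word. -/
def catW {A : Type*} (u : List A) (w : ℕ → A) : ℕ → A := fun n =>
  if h : n < u.length then u.get ⟨n, h⟩ else w (n - u.length)

/-- `u` is the lexicographically smallest factor of `w` of length `k`,
w.r.t. the strict order `lt` on letters. -/
def IsMinFactor {A : Type*} (lt : A → A → Prop) (w : ℕ → A) (k : ℕ) (u : List A) : Prop :=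
  IsFactor w u ∧ u.length = k ∧
    ∀ v, IsFactor w v → v.length = k → u = v ∨ List.Lex lt u v

/-- `u` is the lexicographically greatest factor of `w` of length `k`. -/
def IsMaxFactor {A : Type*} (lt : A → A → Prop) (w : ℕ → A) (k : ℕ) (u : List A) : Prop :=
  IsFactor w u ∧ u.length = k ∧
    ∀ v, IsFactor w v → v.length = k → u = v ∨ List.Lex lt v u

/-- `m = min(w)`: every length-`k` prefix of `m` is the lexicographically
smallest factor of `w` of length `k`. -/
def IsMinWord {A : Type*} (lt : A → A → Prop) (w m : ℕ → A) : Prop :=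
  ∀ k : ℕ, IsMinFactor lt w k (pref m k)

/-- `m = max(w)`. -/
def IsMaxWord {A : Type*} (lt : A → A → Prop) (w m : ℕ → A) : Prop :=
  ∀ k : ℕ, IsMaxFactor lt w k (pref m k)

/-- The letter `z` is separating for `t`: every length-2 factor of `t` contains `z`. -/
def Separating {A : Type*} (z : A) (t : ℕ → A) : Prop :=
  ∀ u, IsFactor t u → u.length = 2 → z ∈ u

/-- The episturmian morphism `Ψ_z` on finite words: `z ↦ z`, `x ↦ zx` for `x ≠ z`. -/
def psiL {A : Type*} [DecidableEq A] (z : A) (u : List A) : List A :=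
  u.flatMap (fun x => if x = z then [z] else [z, x])

/-- `t = Ψ_z(y)` for infinite words: the `Ψ_z`-image of every prefix of `y`
is a prefix of `t`. -/
def PsiImage {A : Type*} [DecidableEq A] (z : A) (y t : ℕ → A) : Prop :=
  ∀ n : ℕ, psiL z (pref y n) = pref t (psiL z (pref y n)).length

/-- `u` is a left special factor of `w`. -/
def LeftSpecial {A : Type*} (w : ℕ → A) (u : List A) : Prop :=
  ∃ a b : A, a ≠ b ∧ IsFactor w (a :: u) ∧ IsFactor w (b :: u)

/-- `u` is a right special factor of `w`. -/
def RightSpecial {A : Type*} (w : ℕ → A) (u : List A) : Prop :=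
  ∃ a b : A, a ≠ b ∧ IsFactor w (u ++ [a]) ∧ IsFactor w (u ++ [b])

/-- `w` is a standard episturmian word: factors closed under reversal and
every left special factor is a prefix. -/
def StdEpisturmian {A : Type*} (w : ℕ → A) : Prop :=
  (∀ u, IsFactor w u → IsFactor w u.reverse) ∧
  (∀ u, LeftSpecial w u → u = pref w u.length)

/-- `w` is an `A`-strict standard episturmian word (standard Arnoux-Rauzy sequence):
standard episturmian and every prefix has every letter as a left extension. -/
def StrictStdEpisturmian {A : Type*} (w : ℕ → A) : Prop :=
  StdEpisturmian w ∧ ∀ (n : ℕ) (a : A), IsFactor w (a :: pref w n)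

/-- `w` is episturmian: factors closed under reversal and at most one right
special factor of each length. -/
def Episturmian {A : Type*} (w : ℕ → A) : Prop :=
  (∀ u, IsFactor w u → IsFactor w u.reverse) ∧
  (∀ u v, RightSpecial w u → RightSpecial w v → u.length = v.length → u = v)

/-- `w` is an `A`-strict episturmian word: it has the same set of factors as some
`A`-strict standard episturmian word. -/
def StrictEpisturmian {A : Type*} (w : ℕ → A) : Prop :=
  ∃ s : ℕ → A, StrictStdEpisturmian s ∧ ∀ u, IsFactor w u ↔ IsFactor s u

/-- `t` is fine: there is an infinite word `s` such that for every total order on the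
alphabet and every letter `a` minimal for that order, `min(t) = a·s`. -/
def Fine {A : Type*} (t : ℕ → A) : Prop :=
  ∃ s : ℕ → A, ∀ (l : LinearOrder A) (a : A), (∀ b, l.le a b) →
    IsMinWord l.lt t (consW a s)

/-- Composition `Ψ_{w₁} ∘ Ψ_{w₂} ∘ ⋯ ∘ Ψ_{wₙ}` of episturmian morphisms indexed by
the list `w`; the pure standard (Sturmian) morphisms are exactly these. -/
def psiComp {A : Type*} [DecidableEq A] (w : List A) : List A → List A :=
  w.foldr (fun c f => psiL c ∘ f) id

/-- `t` is a Sturmian word: aperiodic with exactly `n + 1` factors of each length `n`. -/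
def Sturmian {A : Type*} (t : ℕ → A) : Prop :=
  (¬ ∃ (i p : ℕ), 0 < p ∧ ∀ n : ℕ, i ≤ n → t (n + p) = t n) ∧
  (∀ n : ℕ, Set.ncard {u : List A | IsFactor t u ∧ u.length = n} = n + 1)


section Fine17

def Occ {A : Type*} (t : ℕ → A) : ℕ → List A → Prop
  | _, [] => True
  | i, c :: u => t i = c ∧ Occ t (i+1) u

def Fac {A : Type*} (t : ℕ → A) (u : List A) : Prop := ∃ i, Occ t i u

theorem occ_iff_range {A : Type*} (t : ℕ → A) (u : List A) : ∀ i,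
    Occ t i u ↔ u = (List.range u.length).map (fun j => t (i + j)) := by
  induction u with
  | nil => intro i; simp [Occ]
  | cons c u ih =>
    intro i
    rw [Occ, ih, List.length_cons, List.range_succ_eq_map]
    simp only [List.map_cons, List.map_map, List.cons.injEq, Nat.add_zero]
    have : ((fun j => t (i + j)) ∘ Nat.succ) = (fun j => t (i + 1 + j)) := by
      funext j; simp only [Function.comp]; congr 1; omega
    rw [this]
    constructor <;> rintro ⟨h1, h2⟩ <;> exact ⟨h1.symm, h2⟩

theorem fac_iff {A : Type*} (t : ℕ → A) (u : List A) : IsFactor t u ↔ Fac t u := by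
  unfold IsFactor Fac
  exact exists_congr fun i => (occ_iff_range t u i).symm

theorem occ_append {A : Type*} (t : ℕ → A) (u v : List A) : ∀ i,
    Occ t i (u ++ v) ↔ Occ t i u ∧ Occ t (i + u.length) v := by
  induction u with
  | nil => intro i; simp [Occ]
  | cons c u ih =>
    intro i
    rw [List.cons_append, Occ, Occ, ih, List.length_cons, and_assoc]
    have : i + 1 + u.length = i + (u.length + 1) := by omega
    rw [this]

theorem occ_get {A : Type*} (t : ℕ → A) (u : List A) : ∀ i,
    Occ t i u ↔ ∀ j (h : j < u.length), t (i + j) = u[j] := by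
  induction u with
  | nil => intro i; simp [Occ]
  | cons c u ih =>
    intro i
    rw [Occ, ih]
    constructor
    · rintro ⟨h1, h2⟩ j hj
      cases j with
      | zero => simpa using h1
      | succ j =>
        have := h2 j (by simpa using hj)
        simp only [List.getElem_cons_succ]
        rw [← this]; congr 1; omega
    · intro h
      refine ⟨h 0 (by simp), fun j hj => ?_⟩
      have := h (j+1) (by simpa using hj)
      simp only [List.getElem_cons_succ] at this
      rw [← this]; congr 1; omega

theorem fac_left {A : Type*} {t : ℕ → A} {u v : List A} (h : Fac t (u ++ v)) : Fac t u := by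
  obtain ⟨i, h⟩ := h
  exact ⟨i, ((occ_append t u v i).1 h).1⟩

theorem fac_right {A : Type*} {t : ℕ → A} {u v : List A} (h : Fac t (u ++ v)) : Fac t v := by
  obtain ⟨i, h⟩ := h
  exact ⟨_, ((occ_append t u v i).1 h).2⟩

theorem occ_win {A : Type*} (t : ℕ → A) (i n : ℕ) :
    Occ t i ((List.range n).map (fun j => t (i + j))) := by
  rw [occ_iff_range]; simp

theorem occ_unique {A : Type*} {t : ℕ → A} {i : ℕ} {u v : List A} (hu : Occ t i u) (hv : Occ t i v)
    (h : u.length = v.length) : u = v := by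
  rw [occ_iff_range] at hu hv
  rw [hu, hv, h]

theorem word_ext {A : Type*} {t t0 : ℕ → A}
    (h : ∀ k, ∃ l : List A, k ≤ l.length ∧ Occ t 0 l ∧ Occ t0 0 l) : t = t0 := by
  funext n
  obtain ⟨l, hl, h1, h2⟩ := h (n+1)
  rw [occ_get] at h1 h2
  have a1 := h1 n (by omega)
  have a2 := h2 n (by omega)
  simp only [Nat.zero_add] at a1 a2
  rw [a1, a2]

/-! ### the morphism -/

section morph
variable {A : Type*} [DecidableEq A]

theorem psiL_nil (z : A) : psiL z [] = [] := rfl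

theorem psiL_append (z : A) (u v : List A) : psiL z (u ++ v) = psiL z u ++ psiL z v := by
  simp [psiL]

theorem psiL_self (z : A) (u : List A) : psiL z (z :: u) = z :: psiL z u := by
  simp [psiL]

theorem psiL_ne {z c : A} (h : c ≠ z) (u : List A) : psiL z (c :: u) = z :: c :: psiL z u := by
  simp [psiL, h]

theorem psiL_length (z : A) (u : List A) : u.length ≤ (psiL z u).length := by
  induction u with
  | nil => simp
  | cons c u ih =>
    by_cases h : c = z
    · subst h; rw [psiL_self]; simpa using ih
    · rw [psiL_ne h]; simp; omega

theorem psiL_length_le (z : A) (u : List A) : (psiL z u).length ≤ 2 * u.length := by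
  induction u with
  | nil => simp [psiL]
  | cons c u ih =>
    by_cases h : c = z
    · subst h; rw [psiL_self]; simp; omega
    · rw [psiL_ne h]; simp; omega

/-- `Ψ_z(q) z` starts with `z`. -/
theorem psiL_head (z : A) (q : List A) : ∃ r, psiL z q ++ [z] = z :: r := by
  cases q with
  | nil => exact ⟨[], rfl⟩
  | cons c u =>
    by_cases h : c = z
    · subst h; rw [psiL_self]; exact ⟨_, rfl⟩
    · rw [psiL_ne h]; exact ⟨_, rfl⟩

structure WRel (z : A) (t' t : ℕ → A) (f : ℕ → ℕ) : Prop where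
  h0 : f 0 = 0 ∨ (f 0 = 1 ∧ t 0 = z ∧ t' 0 ≠ z)
  hl : ∀ i, t (f i) = t' i
  hz : ∀ i, t (f i + 1) = z
  hs : ∀ i, f (i+1) = f i + if t' (i+1) = z then 1 else 2

variable {z y : A} {t' t : ℕ → A} {f : ℕ → ℕ}

theorem WRel.range (R : WRel z t' t f) (n : ℕ) :
    (∃ i, f i = n) ∨ (∃ i, f i = n + 1 ∧ t n = z ∧ t' i ≠ z) := by
  induction n with
  | zero =>
    rcases R.h0 with h | ⟨h, h1, h2⟩
    · exact Or.inl ⟨0, h⟩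
    · exact Or.inr ⟨0, h, h1, h2⟩
  | succ n ih =>
    rcases ih with ⟨i, hi⟩ | ⟨i, hi, -, -⟩
    · have hs := R.hs i
      by_cases h : t' (i+1) = z
      · left; exact ⟨i+1, by rw [hs, if_pos h, hi]⟩
      · right; exact ⟨i+1, by rw [hs, if_neg h, hi], by rw [← hi]; exact R.hz i, h⟩
    · exact Or.inl ⟨i, hi⟩

theorem WRel.sep (R : WRel z t' t f) (n : ℕ) : t n = z ∨ t (n+1) = z := by
  rcases R.range n with ⟨i, rfl⟩ | ⟨i, -, h, -⟩
  · exact Or.inr (R.hz i)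
  · exact Or.inl h

theorem WRel.mono (R : WRel z t' t f) : StrictMono f := by
  apply strictMono_nat_of_lt_succ
  intro n
  rw [R.hs]; split <;> omega

theorem WRel.occ (R : WRel z t' t f) (q : List A) : ∀ i,
    Occ t (f i + 1) (psiL z q ++ [z]) ↔ Occ t' (i+1) q := by
  induction q with
  | nil => intro i; simp [psiL_nil, Occ, R.hz]
  | cons d q ih =>
    intro i
    have hs := R.hs i
    have hz := R.hz i
    have hl := R.hl (i+1)
    have hz' := R.hz (i+1)
    by_cases h : d = z
    · subst h
      rw [psiL_self, List.cons_append, Occ, Occ]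
      by_cases h' : t' (i+1) = d
      · rw [if_pos h'] at hs
        rw [← ih (i+1), hs]
        simp [hz, h']
      · rw [if_neg h'] at hs
        obtain ⟨r, hr⟩ := psiL_head d q
        rw [hr, Occ]
        rw [hs] at hl
        constructor
        · rintro ⟨-, h2, -⟩
          exact absurd (hl.symm.trans h2) h'
        · rintro ⟨h2, -⟩; exact absurd h2 h'
    · rw [psiL_ne h, List.cons_append, List.cons_append, Occ, Occ, Occ]
      by_cases h' : t' (i+1) = z
      · rw [if_pos h'] at hs
        rw [hs] at hz'
        constructor
        · rintro ⟨-, h2, -⟩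
          exact absurd (h2.symm.trans hz') h
        · rintro ⟨h2, -⟩; exact absurd (h2.symm.trans h') h
      · rw [if_neg h'] at hs
        rw [← ih (i+1), hs]
        rw [hs] at hl
        simp [hz, ← hl]

theorem WRel.fac (R : WRel z t' t f) (c : A) (q : List A) :
    Fac t (c :: (psiL z q ++ [z])) ↔ Fac t' (c :: q) := by
  constructor
  · rintro ⟨n, h1, h2⟩
    rcases R.range n with ⟨i, rfl⟩ | ⟨i, hi, -, hne⟩
    · exact ⟨i, (R.hl i).symm.trans h1, (R.occ q i).1 h2⟩
    · obtain ⟨r, hr⟩ := psiL_head z q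
      rw [hr, Occ, ← hi, R.hl] at h2
      exact absurd h2.1 hne
  · rintro ⟨i, h1, h2⟩
    exact ⟨f i, (R.hl i).trans h1, (R.occ q i).2 h2⟩

theorem WRel.fac2 (R : WRel z t' t f) (c d : A) (r : List A) :
    Fac t' (c :: (r ++ [d])) ↔ Fac t (c :: ((psiL z r ++ [z]) ++ [d])) := by
  rw [← R.fac, psiL_append]
  by_cases h : d = z
  · subst h
    rw [psiL_self, psiL_nil]
  · rw [psiL_ne h, psiL_nil]
    have e : c :: (psiL z r ++ [z, d] ++ [z]) = (c :: ((psiL z r ++ [z]) ++ [d])) ++ [z] := by simp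
    rw [e]
    constructor
    · exact fac_left
    · rintro ⟨i, hi⟩
      refine ⟨i, (occ_append _ _ _ _).2 ⟨hi, ?_⟩⟩
      have e2 : c :: (psiL z r ++ [z] ++ [d]) = (c :: (psiL z r ++ [z])) ++ [d] := by simp
      rw [e2, occ_append] at hi
      refine ⟨?_, trivial⟩
      rw [e2, List.length_append, ← Nat.add_assoc]
      rcases R.sep (i + (c :: (psiL z r ++ [z])).length) with h' | h'
      · exact absurd (hi.2.1.symm.trans h') h
      · exact h'

/-- parsing -/
theorem parse (hsep : ∀ n, t n = z ∨ t (n+1) = z) : ∀ (m : ℕ) (u : List A), u.length ≤ m → ∀ i,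
    Occ t i (z :: u) → (z :: u).getLast (by simp) = z → ∃ q, z :: u = psiL z q ++ [z] := by
  intro m
  induction m with
  | zero =>
    intro u hu i _ _
    have : u = [] := by simpa using hu
    subst this
    exact ⟨[], rfl⟩
  | succ m ih =>
    intro u hu i ho hlast
    match u, hu, ho, hlast with
    | [], _, _, _ => exact ⟨[], rfl⟩
    | d :: u, hu, ho, hlast =>
      by_cases h : d = z
      · subst h
        obtain ⟨q, hq⟩ := ih u (by simpa using hu) (i+1) ho.2 (by simpa using hlast)
        exact ⟨d :: q, by rw [psiL_self, List.cons_append, ← hq]⟩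
      · match u, hu, ho, hlast with
        | [], _, _, hlast => simp at hlast; exact absurd hlast h
        | e :: u, hu, ho, hlast =>
          have he : e = z := by
            rcases hsep (i+1) with h' | h'
            · exact absurd (ho.2.1.symm.trans h') h
            · exact ho.2.2.1.symm.trans h'
          subst he
          obtain ⟨q, hq⟩ := ih u (by simp at hu; omega) (i+1+1) ho.2.2 (by simpa using hlast)
          exact ⟨d :: q, by rw [psiL_ne h, List.cons_append, List.cons_append, ← hq]⟩

theorem exists_rel_down (hsep : ∀ n, t n = z ∨ t (n+1) = z) : ∃ t' f, WRel z t' t f := by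
  let g : ℕ → ℕ := fun m => if t (m+2) = z then m + 1 else m + 2
  let f : ℕ → ℕ := fun n => Nat.rec (if t 0 = z ∧ t 1 ≠ z then 1 else 0) (fun _ m => g m) n
  have f0 : f 0 = if t 0 = z ∧ t 1 ≠ z then 1 else 0 := rfl
  have fs : ∀ n, f (n+1) = if t (f n+2) = z then f n + 1 else f n + 2 := fun n => rfl
  have hz : ∀ i, t (f i + 1) = z := by
    intro i
    induction i with
    | zero =>
      rw [f0]
      split_ifs with h
      · exact (hsep 1).resolve_left h.2
      · by_contra h1
        exact h ⟨(hsep 0).resolve_right h1, h1⟩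
    | succ n ih =>
      rw [fs]
      split_ifs with h
      · exact h
      · exact (hsep (f n + 2)).resolve_left h
  refine ⟨fun i => t (f i), f, ?_, fun i => rfl, hz, ?_⟩
  · by_cases h : t 0 = z ∧ t 1 ≠ z
    · rw [if_pos h] at f0
      exact Or.inr ⟨f0, h.1, by simp only [f0]; exact h.2⟩
    · rw [if_neg h] at f0; exact Or.inl f0
  · intro i
    have h1 := fs i
    split_ifs at h1 with h
    · rw [if_pos (by simp only [h1]; exact hz i)]; exact h1
    · rw [if_neg (by simp only [h1]; exact h)]; exact h1

theorem exists_rel_up (t' : ℕ → A) (z : A) (e : ℕ) (he : e = 0 ∨ (e = 1 ∧ t' 0 ≠ z)) :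
    ∃ t f, WRel z t' t f ∧ f 0 = e := by
  classical
  let f : ℕ → ℕ := fun n => Nat.rec e (fun i m => m + if t' (i+1) = z then 1 else 2) n
  have f0 : f 0 = e := rfl
  have fs : ∀ n, f (n+1) = f n + if t' (n+1) = z then 1 else 2 := fun n => rfl
  have hm : StrictMono f := by
    apply strictMono_nat_of_lt_succ
    intro n
    rw [fs]; split <;> omega
  let t : ℕ → A := fun n => @dite A (∃ i : ℕ, f i = n) (Classical.propDecidable _) (fun h => t' h.choose) (fun _ => z)
  have tl : ∀ i, t (f i) = t' i := by
    intro i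
    have h : ∃ j, f j = f i := ⟨i, rfl⟩
    have : t (f i) = t' h.choose := dif_pos h
    rw [this, hm.injective h.choose_spec]
  have tn : ∀ n, (¬ ∃ i, f i = n) → t n = z := fun n h => dif_neg h
  refine ⟨t, f, ⟨?_, tl, ?_, fs⟩, f0⟩
  · rcases he with he | ⟨he, h1⟩
    · exact Or.inl (f0.trans he)
    · refine Or.inr ⟨f0.trans he, tn 0 ?_, h1⟩
      rintro ⟨i, hi⟩
      have := hm.monotone (Nat.zero_le i)
      omega
  · intro i
    by_cases h : t' (i+1) = z
    · have := fs i
      rw [if_pos h] at this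
      exact (congrArg t this.symm).trans ((tl (i+1)).trans h)
    · have h2 := fs i
      rw [if_neg h] at h2
      apply tn
      rintro ⟨j, hj⟩
      have h3 : i < j := hm.lt_iff_lt.1 (by omega)
      have h4 : j < i + 1 := hm.lt_iff_lt.1 (by omega)
      omega

end morph

def Bal {A : Type*} (t : ℕ → A) : Prop :=
  ∀ (p : List A) (c d : A), c ≠ d → Fac t (c :: (p ++ [c])) → Fac t (d :: (p ++ [d])) → False

def NoFork {A : Type*} (t : ℕ → A) : Prop := ¬ ∃ r : List A, ∀ c d, Fac t (c :: (r ++ [d]))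

def LSL {A : Type*} (t : ℕ → A) : Prop := ∀ n : ℕ, ∃ u : List A, n ≤ u.length ∧ ∀ c, Fac t (c :: u)

def EvP {A : Type*} (t : ℕ → A) : Prop := ∃ (i p : ℕ), 0 < p ∧ ∀ n : ℕ, i ≤ n → t (n + p) = t n

section step
variable {A : Type*} [DecidableEq A] {z y : A} {t' t : ℕ → A} {f : ℕ → ℕ}

/-- shape of an interior word `p` with `z p z` and `y p y` factors, `z` separating. -/
theorem shape (hzy : z ≠ y) (hsep : ∀ n, t n = z ∨ t (n+1) = z) {p : List A}
    (h : Fac t (y :: (p ++ [y]))) : ∃ q, p = psiL z q ++ [z] := by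
  obtain ⟨i, h1, h2⟩ := h
  have h3 : t (i+1) = z := (hsep i).resolve_left (fun h => hzy (h.symm.trans h1))
  cases p with
  | nil => exact absurd (h3.symm.trans h2.1) hzy
  | cons d p =>
    have hd : d = z := h2.1.symm.trans h3
    subst hd
    have h4 := (occ_append _ _ _ _).1 h2
    refine parse hsep _ p le_rfl _ h4.1 ?_
    by_contra hne
    have e : d :: p = (d :: p).dropLast ++ [(d :: p).getLast (by simp)] :=
      (List.dropLast_append_getLast _).symm
    have h5 := h4.1
    rw [e, occ_append] at h5
    have h6 := h4.2.1
    have h7 := h5.2.1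
    rcases hsep (i + 1 + (d :: p).dropLast.length) with h8 | h8
    · exact hne (h7.symm.trans h8)
    · have : i + 1 + (d :: p).dropLast.length + 1 = i + 1 + (d :: p).length := by
        simp; omega
      rw [this] at h8
      exact hzy (h8.symm.trans h6)

theorem WRel.bal_down (R : WRel z t' t f) (h : Bal t) : Bal t' := by
  intro p c d hcd h1 h2
  exact h _ c d hcd ((R.fac2 c c p).1 h1) ((R.fac2 d d p).1 h2)

theorem WRel.bal_up (hzy : z ≠ y) (hA : ∀ c, c = z ∨ c = y) (R : WRel z t' t f) (h : Bal t') :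
    Bal t := by
  have key : ∀ p, Fac t (z :: (p ++ [z])) → Fac t (y :: (p ++ [y])) → False := by
    intro p h1 h2
    obtain ⟨q, rfl⟩ := shape hzy R.sep h2
    exact h q z y hzy ((R.fac2 z z q).2 h1) ((R.fac2 y y q).2 h2)
  intro p c d hcd h1 h2
  rcases hA c with rfl | rfl <;> rcases hA d with rfl | rfl
  · exact hcd rfl
  · exact key p h1 h2
  · exact key p h2 h1
  · exact hcd rfl

theorem WRel.noFork_down (R : WRel z t' t f) (h : NoFork t) : NoFork t' := by
  rintro ⟨r, hr⟩
  exact h ⟨_, fun c d => (R.fac2 c d r).1 (hr c d)⟩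

theorem WRel.lsl_up (R : WRel z t' t f) (h : LSL t') : LSL t := by
  intro n
  obtain ⟨u, hu, h⟩ := h n
  refine ⟨psiL z u ++ [z], ?_, fun c => (R.fac c u).2 (h c)⟩
  have := psiL_length z u
  simp; omega

theorem WRel.lsl_down (hzy : z ≠ y) (R : WRel z t' t f)
    (h : LSL t) : LSL t' := by
  intro n
  obtain ⟨u, hu, h⟩ := h (2 * n + 2)
  have hsep := R.sep
  -- a truncation ending with `z`
  have : ∃ u1 u2, u = u1 ++ u2 ∧ 2 * n + 1 ≤ u1.length ∧ ∃ h : u1 ≠ [], u1.getLast h = z := by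
    have hne : u ≠ [] := by rintro rfl; simp at hu
    by_cases hl : u.getLast hne = z
    · exact ⟨u, [], by simp, by omega, hne, hl⟩
    · have e := List.dropLast_append_getLast hne
      have hlen : u.dropLast.length = u.length - 1 := by simp
      have hne2 : u.dropLast ≠ [] := by
        intro h0; rw [h0] at hlen; simp at hlen; omega
      refine ⟨u.dropLast, [u.getLast hne], e.symm, by omega, hne2, ?_⟩
      by_contra hl2
      have e2 := List.dropLast_append_getLast hne2
      obtain ⟨i, hi⟩ := fac_right (u := [z]) (h z)
      rw [← e, ← e2, List.append_assoc, occ_append] at hi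
      have h1 := hi.2.1
      have h2 := hi.2.2.1
      rcases hsep (i + u.dropLast.dropLast.length) with h8 | h8
      · exact hl2 (h1.symm.trans h8)
      · exact hl (h2.symm.trans h8)
  obtain ⟨u1, u2, rfl, hlen, hne, hlast⟩ := this
  have hq : ∃ q, u1 = psiL z q ++ [z] := by
    obtain ⟨i, h1, h2⟩ := h y
    have h3 : t (i+1) = z := (hsep i).resolve_left (fun h => hzy (h.symm.trans h1))
    cases u1 with
    | nil => exact absurd rfl hne
    | cons d p =>
      have hd : d = z := h2.1.symm.trans h3
      subst hd
      exact parse hsep _ p le_rfl _ ((occ_append _ _ _ _).1 h2).1 hlast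
  obtain ⟨q, rfl⟩ := hq
  refine ⟨q, ?_, fun c => (R.fac c q).1 ?_⟩
  · have := psiL_length_le z q
    simp at hlen; omega
  · have := h c
    rw [← List.cons_append] at this
    exact fac_left this

theorem WRel.evp_up (R : WRel z t' t f) (h : EvP t') : EvP t := by
  obtain ⟨N, P, hP, h⟩ := h
  have hm := R.mono
  have hQ : ∀ k, f (N + k + P) + f N = f (N + k) + f (N + P) := by
    intro k
    induction k with
    | zero => simp; omega
    | succ k ih =>
      have h1 := R.hs (N + k + P)
      have h2 := R.hs (N + k)
      have h3 := h (N + k + 1) (by omega)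
      have e : N + k + 1 + P = N + k + P + 1 := by omega
      rw [e] at h3
      rw [h3] at h1
      have e2 : N + (k + 1) + P = N + k + P + 1 := by omega
      rw [e2, ← Nat.add_assoc N k 1]
      omega
  have hlt : f N < f (N + P) := hm (by omega)
  obtain ⟨Q, hQ0⟩ : ∃ Q, f (N + P) = f N + Q := ⟨_, (Nat.add_sub_cancel' hlt.le).symm⟩
  have hQ' : ∀ i, N ≤ i → f (i + P) = f i + Q := by
    intro i hi
    obtain ⟨k, rfl⟩ := Nat.exists_eq_add_of_le hi
    have := hQ k
    omega
  refine ⟨f N, Q, by omega, ?_⟩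
  intro n hn
  rcases R.range n with ⟨i, hi⟩ | ⟨i, hi, h1, h2⟩
  · have : N ≤ i := hm.le_iff_le.1 (by omega)
    rw [← hi, ← hQ' i this, R.hl, R.hl, h i this]
  · have hNi : N < i := hm.lt_iff_lt.1 (by omega)
    have h3 := hQ' i hNi.le
    obtain ⟨j, rfl⟩ : ∃ j, i = j + 1 := ⟨i - 1, by omega⟩
    have h4 := R.hs (j + P)
    have h5 := h (j + 1) hNi.le
    have e : j + 1 + P = j + P + 1 := by omega
    rw [e] at h5 h3
    rw [if_neg (by rw [h5]; exact h2)] at h4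
    have h6 := R.hz (j + P)
    rw [h1]
    have : n + Q = f (j + P) + 1 := by omega
    rw [this, h6]

/-- period decreases under desubstitution -/
theorem WRel.evp_down (hzy : z ≠ y) (R : WRel z t' t f) {N P : ℕ} (hP : 0 < P)
    (h : ∀ n, N ≤ n → t (n + P) = t n) {n : ℕ} (hn : N + 2 ≤ n) (hny : t n = y) :
    ∃ N' P', 0 < P' ∧ P' < P ∧ ∀ n, N' ≤ n → t' (n + P') = t' n := by
  have hm := R.mono
  have hr : ∀ n, (∃ i, f i = n) ↔ (t n ≠ z ∨ t (n+1) = z) := by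
    intro n
    constructor
    · rintro ⟨i, rfl⟩; exact Or.inr (R.hz i)
    · intro hn
      rcases R.range n with h1 | ⟨i, h1, h2, h3⟩
      · exact h1
      · rcases hn with h4 | h4
        · exact absurd h2 h4
        · rw [← h1, R.hl] at h4; exact absurd h4 h3
  obtain ⟨i1, hi1⟩ := (hr n).2 (Or.inl (by rw [hny]; exact hzy.symm))
  have hi0 : i1 ≠ 0 := by
    rintro rfl
    rcases R.h0 with h0 | h0 <;> omega
  obtain ⟨i, rfl⟩ : ∃ j, i1 = j + 1 := ⟨i1 - 1, by omega⟩
  have hty : t' (i+1) = y := by rw [← R.hl, hi1, hny]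
  have hstep := R.hs i
  rw [hty, if_neg hzy.symm] at hstep
  have hN : N ≤ f i := by omega
  obtain ⟨j, hj⟩ := (hr (f i + P)).2 (Or.inr (by
    have := h (f i + 1) (by omega)
    rw [show f i + P + 1 = f i + 1 + P by omega, this]; exact R.hz i))
  have hij : i < j := hm.lt_iff_lt.1 (by omega)
  obtain ⟨k, rfl⟩ : ∃ k, j = i + 1 + k := ⟨j - (i+1), by omega⟩
  have hk : ∀ k, f (i+1) + k ≤ f (i + 1 + k) := by
    intro k
    induction k with
    | zero => simp
    | succ k ih =>
      have := hm (show i + 1 + k < i + 1 + (k+1) by omega)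
      omega
  have hsh : ∀ m, f (i + m + (k + 1)) = f (i + m) + P := by
    intro m
    induction m with
    | zero => rw [Nat.add_zero, ← hj]; congr 1; omega
    | succ m ih =>
      have h1 := R.hs (i + m + (k+1))
      have h2 := R.hs (i + m)
      have hmono : f i ≤ f (i + m) := hm.monotone (by omega)
      have key : t' (i + m + (k+1) + 1) = z ↔ t' (i + m + 1) = z := by
        have a1 : ∀ l, t' (l+1) = z ↔ t (f l + 2) = z := by
          intro l
          have b1 := R.hs l
          by_cases hc : t' (l+1) = z
          · rw [if_pos hc] at b1
            have := R.hz (l+1)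
            rw [b1] at this
            exact ⟨fun _ => this, fun _ => hc⟩
          · rw [if_neg hc] at b1
            rw [← b1, R.hl]
        rw [a1, a1, ih, show f (i+m) + P + 2 = f (i+m) + 2 + P by omega, h _ (by omega)]
      rw [show i + (m+1) + (k+1) = i + m + (k+1) + 1 by omega, h1, ih,
        show i + (m+1) = i + m + 1 by omega, h2]
      simp only [key]
      omega
  refine ⟨i, k + 1, by omega, ?_, ?_⟩
  · have := hk k; omega
  · intro l hl
    obtain ⟨m, rfl⟩ := Nat.exists_eq_add_of_le hl
    have hmono : f i ≤ f (i + m) := hm.monotone (by omega)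
    rw [← R.hl, hsh, h _ (by omega), R.hl]

end step

/-- separating letter -/
theorem sep_of_not_fac {A : Type*} {z y : A} (hA : ∀ c : A, c = z ∨ c = y) {t : ℕ → A}
    (h : ¬ Fac t [y, y]) (n : ℕ) : t n = z ∨ t (n+1) = z := by
  rcases hA (t n) with h1 | h1
  · exact Or.inl h1
  · rcases hA (t (n+1)) with h2 | h2
    · exact Or.inr h2
    · exact absurd ⟨n, h1, h2, trivial⟩ h

theorem fac_change {A : Type*} {z y : A} (hA : ∀ c : A, c = z ∨ c = y) {t : ℕ → A}
    (hap : ¬ EvP t) : Fac t [z, y] := by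
  by_contra h
  have hst : ∀ n, t n = z → t (n+1) = z := by
    intro n hn
    rcases hA (t (n+1)) with h2 | h2
    · exact h2
    · exact absurd ⟨n, hn, h2, trivial⟩ h
  apply hap
  by_cases hex : ∃ n, t n = z
  · obtain ⟨n, hn⟩ := hex
    have : ∀ m, n ≤ m → t m = z := by
      intro m hm
      induction m, hm using Nat.le_induction with
      | base => exact hn
      | succ m _ ih => exact hst m ih
    exact ⟨n, 1, one_pos, fun m hm => by rw [this m hm, this _ (by omega)]⟩
  · push Not at hex
    have : ∀ m, t m = y := fun m => (hA (t m)).resolve_left (hex m)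
    exact ⟨0, 1, one_pos, fun m _ => by rw [this, this]⟩

theorem noFork_two {A : Type*} {z y : A} (hA : ∀ c : A, c = z ∨ c = y) {t : ℕ → A}
    (hap : ¬ EvP t) (hf : NoFork t) : ¬ (Fac t [z, z] ∧ Fac t [y, y]) := by
  rintro ⟨h1, h2⟩
  refine hf ⟨[], fun c d => ?_⟩
  have h3 := fac_change hA hap
  have h4 := fac_change (fun c => (hA c).symm) hap
  rcases hA c with rfl | rfl <;> rcases hA d with rfl | rfl <;> assumption

theorem bal_of_noFork {A : Type*} [DecidableEq A] {z y : A} (hzy : z ≠ y) (hA : ∀ c : A, c = z ∨ c = y) :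
    ∀ (m : ℕ) (t : ℕ → A), ¬ EvP t → NoFork t → ∀ p : List A, p.length ≤ m →
      Fac t (z :: (p ++ [z])) → Fac t (y :: (p ++ [y])) → False := by
  intro m
  induction m with
  | zero =>
    intro t hap hf p hp h1 h2
    have : p = [] := by simpa using hp
    subst this
    exact noFork_two hA hap hf ⟨h1, h2⟩
  | succ m ih =>
    intro t hap hf p hp h1 h2
    by_cases hyy : Fac t [y, y]
    · have hzz : ¬ Fac t [z, z] := fun h => noFork_two hA hap hf ⟨h, hyy⟩
      obtain ⟨t', f, R⟩ := exists_rel_down (sep_of_not_fac (fun c => (hA c).symm) hzz)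
      obtain ⟨q, rfl⟩ := shape hzy.symm R.sep h1
      refine ih t' (fun h => hap (R.evp_up h)) (R.noFork_down hf) q ?_
        ((R.fac2 z z q).2 h1) ((R.fac2 y y q).2 h2)
      have := psiL_length y q
      simp at hp; omega
    · obtain ⟨t', f, R⟩ := exists_rel_down (sep_of_not_fac hA hyy)
      obtain ⟨q, rfl⟩ := shape hzy R.sep h2
      refine ih t' (fun h => hap (R.evp_up h)) (R.noFork_down hf) q ?_
        ((R.fac2 z z q).2 h1) ((R.fac2 y y q).2 h2)
      have := psiL_length z q
      simp at hp; omega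

/-! ### counting -/

section counting
variable {A : Type*}

def FS (t : ℕ → A) (n : ℕ) : Set (List A) := {u | Fac t u ∧ u.length = n}

def RS (t : ℕ → A) (n : ℕ) : Set (List A) := {u | u.length = n ∧ ∀ d, Fac t (u ++ [d])}

theorem FS_finite {z y : A} (hA : ∀ c : A, c = z ∨ c = y) (t : ℕ → A) (n : ℕ) : (FS t n).Finite := by
  have : Finite A := Finite.of_surjective (fun b : Bool => if b then z else y) (by
    intro c
    rcases hA c with rfl | rfl
    · exact ⟨true, rfl⟩
    · exact ⟨false, rfl⟩)
  exact (List.finite_length_eq A n).subset (fun u hu => hu.2)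

theorem FS_count {z y : A} (hzy : z ≠ y) (hA : ∀ c : A, c = z ∨ c = y) (t : ℕ → A) (n : ℕ) :
    (FS t (n+1)).ncard = (FS t n).ncard + (RS t n).ncard := by
  let Z : A → Set (List A) := fun d => {u | u.length = n ∧ Fac t (u ++ [d])}
  have hsub : ∀ d, Z d ⊆ FS t n := fun d u hu => ⟨fac_left hu.2, hu.1⟩
  have hfin : ∀ d, (Z d).Finite := fun d => (FS_finite hA t n).subset (hsub d)
  have h1 : Z z ∪ Z y = FS t n := by
    apply Set.Subset.antisymm (Set.union_subset (hsub z) (hsub y))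
    rintro u ⟨⟨i, hi⟩, hu⟩
    have : ∀ d, t (i + u.length) = d → u ∈ Z d := fun d hd =>
      ⟨hu, i, (occ_append _ _ _ _).2 ⟨hi, hd, trivial⟩⟩
    rcases hA (t (i + u.length)) with h | h
    · exact Or.inl (this _ h)
    · exact Or.inr (this _ h)
  have h2 : Z z ∩ Z y = RS t n := by
    ext u
    constructor
    · rintro ⟨hz, hy⟩
      refine ⟨hz.1, fun d => ?_⟩
      rcases hA d with rfl | rfl
      · exact hz.2
      · exact hy.2
    · rintro ⟨h, h'⟩
      exact ⟨⟨h, h' z⟩, ⟨h, h' y⟩⟩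
  have h3 : FS t (n+1) = Set.image (fun u => u ++ [z]) (Z z) ∪ Set.image (fun u => u ++ [y]) (Z y) := by
    ext u
    constructor
    · rintro ⟨hu, hl⟩
      have hne : u ≠ [] := by rintro rfl; simp at hl
      have e := List.dropLast_append_getLast hne
      have hlen : u.dropLast.length = n := by simp [hl]
      rcases hA (u.getLast hne) with h | h
      · left; rw [h] at e
        exact ⟨u.dropLast, ⟨hlen, by rw [e]; exact hu⟩, e⟩
      · right; rw [h] at e
        exact ⟨u.dropLast, ⟨hlen, by rw [e]; exact hu⟩, e⟩
    · rintro (⟨v, hv, rfl⟩ | ⟨v, hv, rfl⟩)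
      · exact ⟨hv.2, by simp [hv.1]⟩
      · exact ⟨hv.2, by simp [hv.1]⟩
  have hinj : ∀ d : A, Function.Injective (fun u : List A => u ++ [d]) := by
    intro d u v h; simpa using h
  rw [h3, Set.ncard_union_eq ?_ ((hfin z).image _) ((hfin y).image _), Set.ncard_image_of_injective _ (hinj z),
    Set.ncard_image_of_injective _ (hinj y), ← h1, ← h2,
    Set.ncard_union_add_ncard_inter _ _ (hfin z) (hfin y)]
  · rw [Set.disjoint_left]
    rintro _ ⟨u, -, rfl⟩ ⟨v, -, h⟩
    have := List.append_inj_right' h rfl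
    simp at this
    exact hzy this.symm

theorem FS_zero (t : ℕ → A) : (FS t 0).ncard = 1 := by
  have : FS t 0 = {[]} := by
    ext u
    constructor
    · rintro ⟨-, h⟩; simpa using h
    · rintro rfl; exact ⟨⟨0, trivial⟩, rfl⟩
  rw [this, Set.ncard_singleton]

theorem RS_nonempty {z y : A} (hA : ∀ c : A, c = z ∨ c = y) {t : ℕ → A} (hap : ¬ EvP t)
    (n : ℕ) : (RS t n).Nonempty := by
  by_contra hemp
  rw [Set.not_nonempty_iff_eq_empty] at hemp
  have hdet : ∀ u : List A, u.length = n → ∀ c d, Fac t (u ++ [c]) → Fac t (u ++ [d]) → c = d := by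
    intro u hu c d hc hd
    by_contra hcd
    have : u ∈ RS t n := by
      refine ⟨hu, fun e => ?_⟩
      have : e = c ∨ e = d := by
        rcases hA c with h | h <;> rcases hA d with h' | h' <;> rcases hA e with h'' | h'' <;>
          simp_all
      rcases this with rfl | rfl <;> assumption
    rw [hemp] at this
    exact this
  let W : ℕ → List A := fun i => (List.range n).map (fun j => t (i + j))
  have hW : ∀ i, Occ t i (W i) := fun i => occ_win t i n
  have hWl : ∀ i, (W i).length = n := fun i => by simp [W]
  have hnext : ∀ i, Occ t i (W i ++ [t (i+n)]) := fun i =>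
    (occ_append _ _ _ _).2 ⟨hW i, by rw [hWl]; exact ⟨rfl, trivial⟩⟩
  have hfin := FS_finite hA t n
  have hni : ¬ Function.Injective W := by
    intro hinj
    exact (Set.infinite_of_injective_forall_mem hinj (s := FS t n)
      (fun i => ⟨⟨i, hW i⟩, hWl i⟩)) hfin
  rw [Function.Injective] at hni
  push Not at hni
  obtain ⟨i0, j0, he0, hne0⟩ := hni
  have main : ∀ i j, i < j → W i = W j → EvP t := by
    intro i j hij he
    have hk : ∀ k, W (i+k) = W (j+k) := by
      intro k
      induction k with
      | zero => exact he
      | succ k ih =>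
        have e1 := hnext (i+k)
        have e2 := hnext (j+k)
        rw [← ih] at e2
        have e3 := hdet _ (hWl (i+k)) _ _ ⟨_, e1⟩ ⟨_, e2⟩
        rw [← e3] at e2
        -- the shifted windows
        apply List.ext_getElem
        · rw [hWl, hWl]
        · intro m hm1 hm2
          rw [hWl] at hm1
          rw [occ_get] at e1 e2
          have a1 := e1 (m+1) (by simp [hWl]; omega)
          have a2 := e2 (m+1) (by simp [hWl]; omega)
          simp only [W, List.getElem_map, List.getElem_range]
          rw [show i + (k+1) + m = i + k + (m+1) by omega,
            show j + (k+1) + m = j + k + (m+1) by omega, a1, a2]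
    refine ⟨i + n, j - i, by omega, ?_⟩
    intro m hm
    obtain ⟨k, rfl⟩ := Nat.exists_eq_add_of_le hm
    have e1 := hnext (i+k)
    have e2 := hnext (j+k)
    rw [← hk k] at e2
    have e3 := hdet _ (hWl (i+k)) _ _ ⟨_, e1⟩ ⟨_, e2⟩
    rw [show i + n + k + (j - i) = j + k + n by omega, ← e3]
    congr 1; omega
  rcases lt_or_gt_of_ne hne0 with h | h
  · exact hap (main _ _ h he0)
  · exact hap (main _ _ h he0.symm)

/-- last difference of two words of the same length -/
theorem last_diff : ∀ (m : ℕ) (u v : List A), u.length = m → v.length = m → u ≠ v →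
    ∃ p c d u' v', c ≠ d ∧ u = u' ++ (c :: p) ∧ v = v' ++ (d :: p) := by
  intro m
  induction m with
  | zero =>
    intro u v hu hv h
    simp at hu hv
    exact absurd (hu.trans hv.symm) h
  | succ m ih =>
    intro u v hu hv h
    match u, v, hu, hv, h with
    | c :: u, d :: v, hu, hv, h =>
      by_cases he : u = v
      · subst he
        exact ⟨u, c, d, [], [], fun hcd => h (by rw [hcd]), rfl, rfl⟩
      · obtain ⟨p, c', d', u', v', h1, h2, h3⟩ :=
          ih u v (by simpa using hu) (by simpa using hv) he
        exact ⟨p, c', d', c :: u', d :: v', h1, by rw [h2]; rfl, by rw [h3]; rfl⟩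

theorem first_diff : ∀ (m : ℕ) (u v : List A), u.length = m → v.length = m → u ≠ v →
    ∃ p c d u' v', c ≠ d ∧ u = p ++ (c :: u') ∧ v = p ++ (d :: v') := by
  intro m
  induction m with
  | zero =>
    intro u v hu hv h
    simp at hu hv
    exact absurd (hu.trans hv.symm) h
  | succ m ih =>
    intro u v hu hv h
    match u, v, hu, hv, h with
    | c :: u, d :: v, hu, hv, h =>
      by_cases he : c = d
      · subst he
        obtain ⟨p, c', d', u', v', h1, h2, h3⟩ :=
          ih u v (by simpa using hu) (by simpa using hv) (fun e => h (by rw [e]))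
        exact ⟨c :: p, c', d', u', v', h1, by rw [h2]; rfl, by rw [h3]; rfl⟩
      · exact ⟨[], c, d, u, v, he, rfl, rfl⟩

theorem RS_unique {t : ℕ → A} (hb : Bal t) {n : ℕ} {u v : List A} (hu : u ∈ RS t n)
    (hv : v ∈ RS t n) : u = v := by
  by_contra h
  obtain ⟨p, c, d, u', v', hcd, h1, h2⟩ := last_diff n u v hu.1 hv.1 h
  have a1 := hu.2 c
  have a2 := hv.2 d
  rw [h1, List.append_assoc] at a1
  rw [h2, List.append_assoc] at a2
  exact hb p c d hcd (fac_right a1) (fac_right a2)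

theorem LS_unique {t : ℕ → A} (hb : Bal t) {u v : List A} (hu : ∀ c, Fac t (c :: u))
    (hv : ∀ c, Fac t (c :: v)) (hl : u.length = v.length) : u = v := by
  by_contra h
  obtain ⟨p, c, d, u', v', hcd, h1, h2⟩ := first_diff _ u v rfl hl.symm h
  have a1 := hu c
  have a2 := hv d
  rw [h1] at a1
  rw [h2] at a2
  refine hb p c d hcd (fac_left (v := u') ?_) (fac_left (v := v') ?_)
  · simpa using a1
  · simpa using a2

theorem fs_eq (t : ℕ → A) (n : ℕ) : {u : List A | IsFactor t u ∧ u.length = n} = FS t n := by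
  ext u; simp [FS, fac_iff]

theorem sturmian_of_bal {z y : A} (hzy : z ≠ y) (hA : ∀ c : A, c = z ∨ c = y) {t : ℕ → A}
    (hap : ¬ EvP t) (hb : Bal t) : Sturmian t := by
  refine ⟨hap, fun n => ?_⟩
  rw [fs_eq]
  induction n with
  | zero => exact FS_zero t
  | succ n ih =>
    rw [FS_count hzy hA, ih]
    congr 1
    obtain ⟨u, hu⟩ := RS_nonempty hA hap n
    rw [Set.ncard_eq_one]
    exact ⟨u, Set.eq_singleton_iff_unique_mem.2 ⟨hu, fun v hv => RS_unique hb hv hu⟩⟩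

theorem Sturmian.noFork {z y : A} (hzy : z ≠ y) (hA : ∀ c : A, c = z ∨ c = y) {t : ℕ → A}
    (h : Sturmian t) : NoFork t := by
  rintro ⟨r, hr⟩
  have h1 := h.2 (r.length + 1)
  have h2 := h.2 (r.length + 2)
  rw [fs_eq] at h1 h2
  rw [FS_count hzy hA, h1] at h2
  have h3 : (RS t (r.length + 1)).ncard = 1 := by omega
  rw [Set.ncard_eq_one] at h3
  obtain ⟨w, hw⟩ := h3
  have hm : ∀ c, (c :: r) ∈ RS t (r.length + 1) := fun c => ⟨by simp, fun d => hr c d⟩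
  rw [hw] at hm
  have a1 : z :: r = w := hm z
  have a2 : y :: r = w := hm y
  have := a1.trans a2.symm
  simp at this
  exact hzy this

theorem Sturmian.lsl {z y : A} (hA : ∀ c : A, c = z ∨ c = y) {t : ℕ → A}
    (h : Sturmian t) : LSL t := by
  intro n
  have h1 := h.2 n
  have h2 := h.2 (n + 1)
  rw [fs_eq] at h1 h2
  obtain ⟨u, hu, v, hv, hne, he⟩ := Set.exists_ne_map_eq_of_ncard_lt_of_maps_to
    (s := FS t (n+1)) (t := FS t n) (f := List.tail) (by omega) (by
      rintro (_ | ⟨c, u⟩) hu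
      · exact absurd hu.2 (by simp)
      · exact ⟨fac_right (u := [c]) hu.1, by simpa using hu.2⟩) (FS_finite hA t n)
  match u, v, hu, hv, hne, he with
  | c :: u, d :: v, hu, hv, hne, he =>
    simp only [List.tail_cons] at he
    subst he
    refine ⟨u, ?_, fun e => ?_⟩
    · have := hu.2; simp at this; omega
    · have : e = c ∨ e = d := by
        have hcd : c ≠ d := fun h => hne (by rw [h])
        rcases hA c with h | h <;> rcases hA d with h' | h' <;> rcases hA e with h'' | h'' <;>
          simp_all
      rcases this with rfl | rfl
      · exact hu.1
      · exact hv.1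
  | [], _, hu, _, _, _ => exact absurd hu.2 (by simp)
  | _ :: _, [], _, hv, _, _ => exact absurd hv.2 (by simp)

end counting

/-! ### fine words -/

theorem pref_length {A : Type*} (w : ℕ → A) (k : ℕ) : (pref w k).length = k := by simp [pref]

theorem pref_cons {A : Type*} (c : A) (s : ℕ → A) (k : ℕ) :
    pref (consW c s) (k+1) = c :: pref s k := by
  unfold pref
  rw [List.range_succ_eq_map, List.map_cons, List.map_map]
  rfl

theorem pref_succ {A : Type*} (s : ℕ → A) (k : ℕ) : pref s (k+1) = pref s k ++ [s k] := by
  unfold pref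
  rw [List.range_succ, List.map_append]; rfl

theorem lex_append {A : Type*} [LinearOrder A] {c d : A} (h : c < d) (p u v : List A) :
    List.Lex (· < ·) (p ++ c :: u) (p ++ d :: v) := by
  induction p with
  | nil => exact List.Lex.rel h
  | cons e p ih => exact List.Lex.cons ih

theorem lex_lt {A : Type*} [LinearOrder A] {u v : List A} : List.Lex (· < ·) u v ↔ u < v :=
  (List.lt_iff_lex_lt u v).symm

theorem lex_cons {A : Type*} [LinearOrder A] {c : A} {u v : List A}
    (h : c :: u = c :: v ∨ List.Lex (· < ·) (c :: u) (c :: v)) : u ≤ v := by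
  rcases h with h | h
  · exact le_of_eq (List.cons.inj h).2
  · cases h with
    | cons h => exact le_of_lt (lex_lt.1 h)
    | rel h => exact absurd h (lt_irrefl _)

theorem fine_iff {A : Type*} [LinearOrder A] {a b : A} (hab : a < b)
    (hA : ∀ c : A, c = a ∨ c = b) (t : ℕ → A) :
    (∃ s : ℕ → A, IsMinWord (· < ·) t (consW a s) ∧ IsMaxWord (· < ·) t (consW b s)) ↔
    (Bal t ∧ LSL t) := by
  constructor
  · rintro ⟨s, h1, h2⟩
    have key : ∀ p, Fac t (a :: (p ++ [a])) → Fac t (b :: (p ++ [b])) → False := by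
      intro p ha hb
      have m1 := (h1 (p.length + 1 + 1)).2.2 _ ((fac_iff _ _).2 ha) (by simp)
      have m2 := (h2 (p.length + 1 + 1)).2.2 _ ((fac_iff _ _).2 hb) (by simp)
      rw [pref_cons] at m1 m2
      have m3 := lex_cons m1
      have m4 := lex_cons (m2.imp Eq.symm id)
      have m5 : p ++ [a] < p ++ [b] := lex_lt.1 (lex_append hab p [] [])
      exact absurd (lt_of_lt_of_le m5 m4) (not_lt.2 m3)
    constructor
    · intro p c d hcd hc hd
      rcases hA c with rfl | rfl <;> rcases hA d with rfl | rfl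
      · exact hcd rfl
      · exact key p hc hd
      · exact key p hd hc
      · exact hcd rfl
    · intro n
      refine ⟨pref s n, by rw [pref_length], fun c => ?_⟩
      rcases hA c with rfl | rfl
      · have := (h1 (n+1)).1
        rwa [pref_cons, fac_iff] at this
      · have := (h2 (n+1)).1
        rwa [pref_cons, fac_iff] at this
  · rintro ⟨hb, hl⟩
    have hl' : ∀ n, ∃ u : List A, u.length = n ∧ ∀ c, Fac t (c :: u) := by
      intro n
      obtain ⟨u, hu, h⟩ := hl n
      refine ⟨u.take n, by simp [hu], fun c => ?_⟩
      have := h c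
      rw [← List.take_append_drop n u, ← List.cons_append] at this
      exact fac_left this
    choose U hU1 hU2 using hl'
    let s : ℕ → A := fun n => (U (n+1)).getD n a
    have hs : ∀ n, U n = pref s n := by
      intro n
      induction n with
      | zero => exact List.eq_nil_of_length_eq_zero (hU1 0)
      | succ n ih =>
        have hlen := hU1 (n+1)
        have hne : U (n+1) ≠ [] := by intro h; rw [h] at hlen; simp at hlen
        have e := List.dropLast_append_getLast hne
        have e1 : (U (n+1)).dropLast = U n := by
          apply LS_unique hb _ (hU2 n)
          · simp [hU1]
          · intro c
            have := hU2 (n+1) c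
            rw [← e, ← List.cons_append] at this
            exact fac_left this
        have e2 : (U (n+1)).getLast hne = s n := by
          simp [s, List.getLast_eq_getElem, hlen]
        rw [pref_succ, ← ih, ← e1, ← e2, e]
    have hfac : ∀ c n, Fac t (c :: pref s n) := fun c n => by rw [← hs]; exact hU2 n c
    have diff : ∀ c u n, u.length = n → Fac t (c :: u) → u ≠ pref s n →
        ∃ p d u' v', c ≠ d ∧ u = p ++ d :: u' ∧ pref s n = p ++ c :: v' := by
      intro c u n hu hf hne
      obtain ⟨p, c', d', u', v', hcd, e1, e2⟩ := first_diff n u _ hu (pref_length s n) hne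
      by_cases hc : c' = c
      · exfalso
        subst hc
        rw [e1, ← List.cons_append] at hf
        have hg := hfac d' n
        rw [e2] at hg
        refine hb p c' d' hcd (fac_left (v := u') ?_) (fac_left (v := v') ?_)
        · simpa using hf
        · simpa using hg
      · have : d' = c := by
          rcases hA c with h | h <;> rcases hA c' with h' | h' <;> rcases hA d' with h'' | h'' <;>
            simp_all
        subst this
        exact ⟨p, c', u', v', Ne.symm hcd, e1, e2⟩
    refine ⟨s, fun k => ?_, fun k => ?_⟩
    · refine ⟨?_, pref_length _ _, ?_⟩
      · cases k with
        | zero => exact ⟨0, rfl⟩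
        | succ k => rw [pref_cons, fac_iff]; exact hfac a k
      · intro v hv hlen
        cases k with
        | zero => left; rw [List.eq_nil_of_length_eq_zero hlen]; rfl
        | succ k =>
          rw [fac_iff] at hv
          rw [pref_cons]
          match v, hv, hlen with
          | c :: u, hv, hlen =>
            rcases hA c with rfl | rfl
            · by_cases he : u = pref s k
              · left; rw [he]
              · right
                obtain ⟨p, d, u', v', h1, h2, h3⟩ := diff c u k (by simpa using hlen) hv he
                have : d = b := (hA d).resolve_left (Ne.symm h1)
                rw [h2, h3]
                exact List.Lex.cons (lex_append (by rw [this]; exact hab) p _ _)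
            · right; exact List.Lex.rel hab
    · refine ⟨?_, pref_length _ _, ?_⟩
      · cases k with
        | zero => exact ⟨0, rfl⟩
        | succ k => rw [pref_cons, fac_iff]; exact hfac b k
      · intro v hv hlen
        cases k with
        | zero => left; rw [List.eq_nil_of_length_eq_zero hlen]; rfl
        | succ k =>
          rw [fac_iff] at hv
          rw [pref_cons]
          match v, hv, hlen with
          | c :: u, hv, hlen =>
            rcases hA c with rfl | rfl
            · right; exact List.Lex.rel hab
            · by_cases he : u = pref s k
              · left; rw [he]
              · right
                obtain ⟨p, d, u', v', h1, h2, h3⟩ := diff c u k (by simpa using hlen) hv he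
                have : d = a := (hA d).resolve_right (Ne.symm h1)
                rw [h2, h3]
                exact List.Lex.cons (lex_append (by rw [this]; exact hab) p _ _)

/-! ### skew words -/

section skew
variable {A : Type*} [DecidableEq A]

theorem psiComp_cons (z : A) (w u : List A) : psiComp (z :: w) u = psiL z (psiComp w u) := rfl

theorem psiComp_append (w u v : List A) : psiComp w (u ++ v) = psiComp w u ++ psiComp w v := by
  induction w with
  | nil => rfl
  | cons z w ih => rw [psiComp_cons, psiComp_cons, psiComp_cons, ih, psiL_append]

theorem psiComp_length (w u : List A) : u.length ≤ (psiComp w u).length := by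
  induction w with
  | nil => exact le_rfl
  | cons z w ih => rw [psiComp_cons]; exact ih.trans (psiL_length _ _)

theorem psiComp_nil (w : List A) : psiComp w [] = [] := by
  induction w with
  | nil => rfl
  | cons z w ih => rw [psiComp_cons, ih]; rfl

/-- The explicit word has the expected prefixes. -/
theorem occ_explicit (w v : List A) (x a : A) (k : ℕ) :
    Occ (catW v (fun n => (psiComp w [x]).getD (n % (psiComp w [x]).length) a)) 0
      (v ++ psiComp w (List.replicate k x)) := by
  have hpos : 0 < (psiComp w [x]).length := psiComp_length w [x]
  generalize hu : psiComp w [x] = u at hpos ⊢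
  set T := catW v (fun n => u.getD (n % u.length) a) with hT
  rw [occ_append]
  constructor
  · rw [occ_get]
    intro j hj
    simp [hT, catW, hj]
  · have : ∀ k m, Occ T (v.length + m * u.length) (psiComp w (List.replicate k x)) := by
      intro k
      induction k with
      | zero => intro m; simp [psiComp_nil, Occ]
      | succ k ih =>
        intro m
        rw [List.replicate_succ, ← List.singleton_append, psiComp_append, hu, occ_append]
        constructor
        · rw [occ_get]
          intro j hj
          have h1 : ¬ (v.length + m * u.length + j < v.length) := by omega
          have h2 : (v.length + m * u.length + j - v.length) = j + m * u.length := by omega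
          simp only [hT, catW, h1, dif_neg, not_false_iff]
          rw [h2, Nat.add_mul_mod_self_right, Nat.mod_eq_of_lt hj]
          simp [hj]
        · have := ih (m+1)
          rw [Nat.add_one_mul, ← Nat.add_assoc] at this
          exact this
    simpa using this k 0

theorem eq_explicit {w v : List A} {x a : A} {t : ℕ → A}
    (h : ∀ k, Occ t 0 (v ++ psiComp w (List.replicate k x))) :
    t = catW v (fun n => (psiComp w [x]).getD (n % (psiComp w [x]).length) a) := by
  apply word_ext
  intro k
  refine ⟨_, ?_, h k, occ_explicit w v x a k⟩
  have := psiComp_length w (List.replicate k x)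
  simp at this ⊢; omega

theorem suffix_psiL {z : A} : ∀ {U v : List A}, v ≠ [] → v <:+ psiL z U →
    ∃ c v'', (c :: v'') <:+ U ∧ (v = c :: psiL z v'' ∨ (c ≠ z ∧ v = z :: c :: psiL z v'')) := by
  intro U
  induction U with
  | nil =>
    intro v hv h
    rw [psiL_nil, List.suffix_nil] at h
    exact absurd h hv
  | cons c U ih =>
    intro v hv h
    have hrec : v <:+ psiL z U → ∃ d v'', (d :: v'') <:+ (c :: U) ∧
        (v = d :: psiL z v'' ∨ (d ≠ z ∧ v = z :: d :: psiL z v'')) := by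
      intro h
      obtain ⟨d, v'', h1, h2⟩ := ih hv h
      exact ⟨d, v'', h1.trans (List.suffix_cons _ _), h2⟩
    by_cases hc : c = z
    · subst hc
      rw [psiL_self, List.suffix_cons_iff] at h
      rcases h with h | h
      · exact ⟨c, U, List.suffix_rfl, Or.inl h⟩
      · exact hrec h
    · rw [psiL_ne hc, List.suffix_cons_iff, List.suffix_cons_iff] at h
      rcases h with h | h | h
      · exact ⟨c, U, List.suffix_rfl, Or.inr ⟨hc, h⟩⟩
      · exact ⟨c, U, List.suffix_rfl, Or.inl h⟩
      · exact hrec h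

/-- prefix transfer -/
theorem WRel.occ_zero {z : A} {t' t : ℕ → A} {f : ℕ → ℕ} (R : WRel z t' t f) {c : A} {q : List A}
    (h : Occ t' 0 (c :: q)) : Occ t (f 0) (c :: psiL z q) := by
  have := (R.occ q 0).2 h.2
  rw [occ_append] at this
  exact ⟨(R.hl 0).trans h.1, this.1⟩

theorem suffix_base {x y : A} : ∀ {p : ℕ} {v : List A}, v ≠ [] → v <:+ List.replicate p x ++ [y] →
    ∃ q, v = List.replicate q x ++ [y] := by
  intro p
  induction p with
  | zero =>
    intro v hv h
    simp only [List.replicate_zero, List.nil_append] at h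
    rw [List.suffix_cons_iff, List.suffix_nil] at h
    exact ⟨0, h.resolve_right hv⟩
  | succ p ih =>
    intro v hv h
    rw [List.replicate_succ, List.cons_append, List.suffix_cons_iff] at h
    rcases h with h | h
    · exact ⟨p+1, h⟩
    · exact ih hv h

theorem base_fine {x y : A} (hxy : x ≠ y) (hA : ∀ c : A, c = x ∨ c = y) {q : ℕ} {t : ℕ → A}
    (h : ∀ k, Occ t 0 (List.replicate q x ++ [y] ++ List.replicate k x)) : Bal t ∧ LSL t := by
  have hq : t q = y := by
    have := h 0
    rw [occ_append, occ_append] at this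
    simpa using this.1.2.1
  have hlow : ∀ n, n < q → t n = x := by
    intro n hn
    have := h 0
    rw [occ_append, occ_append] at this
    have := (occ_get _ _ _).1 this.1.1 n (by simpa using hn)
    simpa using this
  have hhigh : ∀ n, q < n → t n = x := by
    intro n hn
    have := h n
    rw [occ_append] at this
    have := (occ_get _ _ _).1 this.2 (n - (q+1)) (by simp; omega)
    simp only [List.length_append, List.length_replicate, List.length_singleton,
      List.getElem_replicate] at this
    rw [← this]; congr 1; omega
  have huniq : ∀ n, t n = y → n = q := by
    intro n hn
    rcases lt_trichotomy n q with h1 | h1 | h1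
    · exact absurd ((hlow n h1).symm.trans hn) hxy
    · exact h1
    · exact absurd ((hhigh n h1).symm.trans hn) hxy
  have key : ∀ p, ¬ Fac t (y :: (p ++ [y])) := by
    rintro p ⟨i, h1, h2⟩
    rw [occ_append] at h2
    have a1 := huniq _ h1
    have a2 := huniq _ h2.2.1
    omega
  constructor
  · intro p c d hcd h1 h2
    rcases hA c with rfl | rfl
    · rcases hA d with rfl | rfl
      · exact hcd rfl
      · exact key p h2
    · exact key p h1
  · intro n
    refine ⟨List.replicate n x, by simp, fun c => ?_⟩
    rcases hA c with rfl | rfl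
    · refine ⟨q+1, hhigh _ (by omega), ?_⟩
      rw [occ_get]; intro j hj
      rw [List.getElem_replicate]; exact hhigh _ (by omega)
    · refine ⟨q, hq, ?_⟩
      rw [occ_get]; intro j hj
      rw [List.getElem_replicate]; exact hhigh _ (by omega)

theorem skew_fine {x y : A} (hxy : x ≠ y) (hA : ∀ c : A, c = x ∨ c = y) (p : ℕ) :
    ∀ (w v : List A) (t : ℕ → A), v ≠ [] → v <:+ psiComp w (List.replicate p x ++ [y]) →
      (∀ k, Occ t 0 (v ++ psiComp w (List.replicate k x))) → Bal t ∧ LSL t := by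
  intro w
  induction w with
  | nil =>
    intro v t hv hs h
    obtain ⟨q, rfl⟩ := suffix_base hv hs
    exact base_fine hxy hA h
  | cons z w ih =>
    intro v t hv hs h
    rw [psiComp_cons] at hs
    obtain ⟨c, v'', hs', hform⟩ := suffix_psiL hv hs
    set t' : ℕ → A := catW (c :: v'') (fun n => (psiComp w [x]).getD (n % (psiComp w [x]).length) x)
      with ht'
    have hocc := occ_explicit w (c :: v'') x x
    rw [← ht'] at hocc
    have ht0 : t' 0 = c := (hocc 0).1
    obtain ⟨hb, hl⟩ := ih _ t' (by simp) hs' hocc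
    obtain ⟨d, hzd, hAd⟩ : ∃ d, z ≠ d ∧ ∀ c : A, c = z ∨ c = d := by
      rcases hA z with rfl | rfl
      · exact ⟨y, hxy, hA⟩
      · exact ⟨x, hxy.symm, fun c => (hA c).symm⟩
    have fin : ∀ t2 f, WRel z t' t2 f → (∀ k, Occ t2 0 (v ++ psiComp (z :: w) (List.replicate k x))) →
        Bal t ∧ LSL t := by
      intro t2 f R h2
      have : t = t2 := (eq_explicit (a := x) h).trans (eq_explicit (a := x) h2).symm
      rw [this]
      exact ⟨R.bal_up hzd hAd hb, R.lsl_up hl⟩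
    rcases hform with hv | ⟨hc, hv⟩
    · obtain ⟨t2, f, R, hf⟩ := exists_rel_up t' z 0 (Or.inl rfl)
      refine fin t2 f R fun k => ?_
      have := R.occ_zero (q := v'' ++ psiComp w (List.replicate k x)) (hocc k)
      rw [hf, psiL_append] at this
      rw [hv, psiComp_cons]
      exact this
    · obtain ⟨t2, f, R, hf⟩ := exists_rel_up t' z 1 (Or.inr ⟨rfl, by rw [ht0]; exact hc⟩)
      refine fin t2 f R fun k => ?_
      have := R.occ_zero (q := v'' ++ psiComp w (List.replicate k x)) (hocc k)
      rw [hf, psiL_append] at this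
      rw [hv, psiComp_cons]
      refine ⟨?_, this⟩
      rcases R.h0 with h0 | h0
      · omega
      · exact h0.2.1

def Skew (t : ℕ → A) : Prop := ∃ (w : List A) (x y : A) (p : ℕ) (v : List A),
  x ≠ y ∧ v ≠ [] ∧ v <:+ psiComp w (List.replicate p x ++ [y]) ∧
    ∀ k, Occ t 0 (v ++ psiComp w (List.replicate k x))

theorem WRel.skew {z : A} {t' t : ℕ → A} {f : ℕ → ℕ} (R : WRel z t' t f) (h : Skew t') : Skew t := by
  obtain ⟨w, x, y, p, v, hxy, hv, hs, ho⟩ := h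
  match v, hv, hs, ho with
  | c :: v, _, hs, ho =>
    obtain ⟨m, hm⟩ := hs
    have hpre := fun k => R.occ_zero (q := v ++ psiComp w (List.replicate k x)) (ho k)
    simp only [psiL_append] at hpre
    rcases R.h0 with h0 | ⟨h0, h1, h2⟩
    · refine ⟨z :: w, x, y, p, c :: psiL z v, hxy, by simp, ?_, fun k => ?_⟩
      · rw [psiComp_cons, ← hm, psiL_append]
        by_cases hc : c = z
        · subst hc; rw [psiL_self]; exact List.suffix_append _ _
        · rw [psiL_ne hc, List.append_cons]
          exact List.suffix_append _ _
      · have := hpre k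
        rw [h0] at this
        exact this
    · have hc : c ≠ z := fun h => h2 ((ho 0).1.trans h)
      refine ⟨z :: w, x, y, p, z :: c :: psiL z v, hxy, by simp, ?_, fun k => ?_⟩
      · rw [psiComp_cons, ← hm, psiL_append, psiL_ne hc]
        exact List.suffix_append _ _
      · have := hpre k
        rw [h0] at this
        exact ⟨h1, this⟩

/-- eventually constant fine words -/
theorem skew_base {z y : A} (hzy : z ≠ y) (hA : ∀ c : A, c = z ∨ c = y) {t : ℕ → A}
    (hb : Bal t) (hl : LSL t) {N : ℕ} (hN : ∀ n, N ≤ n → t n = z) : Skew t := by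
  have hex : ∃ n, t n = y := by
    obtain ⟨u, -, h⟩ := hl 0
    obtain ⟨i, hi⟩ := h y
    exact ⟨i, hi.1⟩
  obtain ⟨q, hq, hmin⟩ : ∃ q, t q = y ∧ ∀ n, n < q → t n = z :=
    ⟨Nat.find hex, Nat.find_spec hex, fun n hn => (hA (t n)).resolve_right (Nat.find_min hex hn)⟩
  have hhigh : ∀ n, q < n → t n = z := by
    by_contra hcon
    push Not at hcon
    have hex2 : ∃ n, q < n ∧ t n = y := by
      obtain ⟨n, h1, h2⟩ := hcon
      exact ⟨n, h1, (hA (t n)).resolve_left h2⟩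
    obtain ⟨r, ⟨hr, hry⟩, hmin2⟩ : ∃ r, (q < r ∧ t r = y) ∧ ∀ n, n < r → ¬ (q < n ∧ t n = y) :=
      ⟨Nat.find hex2, Nat.find_spec hex2, fun n hn => Nat.find_min hex2 hn⟩
    refine hb (List.replicate (r - q - 1) z) z y hzy ⟨N, hN _ le_rfl, ?_⟩ ⟨q, hq, ?_⟩
    · rw [occ_append]
      refine ⟨?_, hN _ (by omega), trivial⟩
      rw [occ_get]; intro j hj
      rw [List.getElem_replicate]; exact hN _ (by omega)
    · rw [occ_append]
      refine ⟨?_, ?_, trivial⟩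
      · rw [occ_get]; intro j hj
        rw [List.getElem_replicate]
        simp at hj
        exact (hA _).resolve_right (fun h => hmin2 (q + 1 + j) (by omega) ⟨by omega, h⟩)
      · rw [List.length_replicate, ← hry]; congr 1; omega
  refine ⟨[], z, y, q, List.replicate q z ++ [y], hzy, by simp, List.suffix_rfl, fun k => ?_⟩
  change Occ t 0 (List.replicate q z ++ [y] ++ List.replicate k z)
  rw [occ_append, occ_append]
  refine ⟨⟨?_, ?_, trivial⟩, ?_⟩
  · rw [occ_get]; intro j hj
    rw [List.getElem_replicate]
    simp at hj
    exact hmin _ (by omega)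
  · simpa using hq
  · rw [occ_get]; intro j hj
    rw [List.getElem_replicate]
    simp only [List.length_append, List.length_replicate, List.length_singleton]
    exact hhigh _ (by omega)

theorem skew_of_fine {a b : A} (hab : a ≠ b) (hA : ∀ c : A, c = a ∨ c = b) :
    ∀ (P : ℕ) (t : ℕ → A) (N : ℕ), 0 < P → (∀ n, N ≤ n → t (n + P) = t n) → Bal t → LSL t →
      Skew t := by
  intro P
  induction P using Nat.strong_induction_on with
  | _ P ih =>
    intro t N hP hper hb hl
    have main : ∀ z y : A, z ≠ y → (∀ c : A, c = z ∨ c = y) → ¬ Fac t [y, y] → Skew t := by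
      intro z y hzy hA hyy
      obtain ⟨t', f, R⟩ := exists_rel_down (sep_of_not_fac hA hyy)
      by_cases hex : ∃ n, N + 2 ≤ n ∧ t n = y
      · obtain ⟨n, hn, hny⟩ := hex
        obtain ⟨N', P', h1, h2, h3⟩ := R.evp_down hzy hP hper hn hny
        exact R.skew (ih P' h2 t' N' h1 h3 (R.bal_down hb) (R.lsl_down hzy hl))
      · push Not at hex
        exact skew_base hzy hA hb hl (N := N + 2)
          (fun n hn => (hA (t n)).resolve_right (hex n hn))
    by_cases hbb : Fac t [b, b]
    · exact main b a hab.symm (fun c => (hA c).symm) (fun h => hb [] a b hab h hbb)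
    · exact main a b hab hA hbb

end skew

end Fine17

/-- Pirillo's characterization of fine words over a two-letter alphabet `{a, b}`,
`a < b`: `t` is fine iff `t` is Sturmian, or `t = v·μ(x)^ω` with `μ` a pure
standard Sturmian morphism and `v` a non-empty suffix of `μ(xᵖy)`. -/
theorem stmt_17 {A : Type*} [LinearOrder A] (a b : A) (hab : a < b)
    (hAB : ∀ c : A, c = a ∨ c = b) (t : ℕ → A) :
    (∃ s : ℕ → A, IsMinWord (· < ·) t (consW a s) ∧ IsMaxWord (· < ·) t (consW b s)) ↔
    (Sturmian t ∨
      ∃ (w : List A) (x y : A) (p : ℕ) (v : List A),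
        x ≠ y ∧ v ≠ [] ∧ v <:+ psiComp w (List.replicate p x ++ [y]) ∧
        t = catW v (fun n => (psiComp w [x]).getD (n % (psiComp w [x]).length) a)) := by
  have hne : a ≠ b := ne_of_lt hab
  rw [fine_iff hab hAB]
  constructor
  · rintro ⟨hb, hl⟩
    by_cases hp : EvP t
    · right
      obtain ⟨N, P, hP, h⟩ := hp
      obtain ⟨w, x, y, p, v, h1, h2, h3, h4⟩ := skew_of_fine hne hAB P t N hP h hb hl
      exact ⟨w, x, y, p, v, h1, h2, h3, eq_explicit h4⟩
    · left
      exact sturmian_of_bal hne hAB hp hb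
  · rintro (h | ⟨w, x, y, p, v, h1, h2, h3, h4⟩)
    · refine ⟨?_, h.lsl hAB⟩
      have key := fun q => bal_of_noFork hne hAB q.length t h.1 (h.noFork hne hAB) q le_rfl
      intro q c d hcd hc hd
      rcases hAB c with rfl | rfl <;> rcases hAB d with rfl | rfl
      · exact hcd rfl
      · exact key q hc hd
      · exact key q hd hc
      · exact hcd rfl
    · have hA : ∀ c : A, c = x ∨ c = y := by
        intro c
        rcases hAB c with h | h <;> rcases hAB x with h' | h' <;> rcases hAB y with h'' | h'' <;>
          simp_all
      refine skew_fine h1 hA p w v t h2 h3 fun k => ?_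
      rw [h4]
      exact occ_explicit w v x a k
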